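/- (Theorem 1, part (ii)) Let ρ be an N×N density matrix and, for each j, write p_3^{(jj)} = Tr(ρ E_jj) = ρ_jj. Then for every pair 1 ≤ j < k ≤ N the off-diagonal matrix element is reconstructed from the dichotomic probabilities as ρ_jk = (p_1^{(jk)} − (p_3^{(jj)} + p_3^{(kk)})/2) − i (p_2^{(jk)} − (p_3^{(jj)} + p_3^{(kk)})/2), and ρ_kj is the complex conjugate of ρ_jk. -/

import Mathlib

open Matrix Complex ComplexOrder

/-- The Hermitian `u(2)` generators acting in the `(j,k)` plane:
`S_0 = (E_jj + E_kk)/2`, `S_1 = (E_jk + E_kj)/2`, `S_2 = -i(E_jk - E_kj)/2`,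
`S_3 = (E_jj - E_kk)/2`. -/
noncomputable def Sgen {N : ℕ} (a : ℕ) (j k : Fin N) : Matrix (Fin N) (Fin N) ℂ :=
  match a with
  | 0 => (1/2 : ℂ) • (Matrix.single j j 1 + Matrix.single k k 1)
  | 1 => (1/2 : ℂ) • (Matrix.single j k 1 + Matrix.single k j 1)
  | 2 => (-Complex.I/2) • (Matrix.single j k 1 - Matrix.single k j 1)
  | 3 => (1/2 : ℂ) • (Matrix.single j j 1 - Matrix.single k k 1)
  | _ => 0

/-- The rank-one projectors `Π_a^{(jk)} = S_0^{(jk)} + S_a^{(jk)}`. -/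
noncomputable def Proj {N : ℕ} (a : ℕ) (j k : Fin N) : Matrix (Fin N) (Fin N) ℂ :=
  Sgen 0 j k + Sgen a j k

/-- Theorem 1, part (ii): the off-diagonal matrix elements of a density matrix are
reconstructed from the dichotomic probabilities, with `p_3^{(jj)} = Tr(ρ E_jj)`:
`ρ_jk = (p_1^{(jk)} - (p_3^{(jj)} + p_3^{(kk)})/2) - i (p_2^{(jk)} - (p_3^{(jj)} + p_3^{(kk)})/2)`
and `ρ_kj = conj ρ_jk`. -/
theorem stmt_4 {N : ℕ} (ρ : Matrix (Fin N) (Fin N) ℂ)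
    (hρ : ρ.PosSemidef) (htr : ρ.trace = 1)
    (j k : Fin N) (hjk : j < k) :
    ρ j k =
      (trace (ρ * Proj 1 j k) -
        (trace (ρ * Matrix.single j j 1) + trace (ρ * Matrix.single k k 1)) / 2) -
      Complex.I * (trace (ρ * Proj 2 j k) -
        (trace (ρ * Matrix.single j j 1) + trace (ρ * Matrix.single k k 1)) / 2) ∧
    ρ k j = starRingEnd ℂ (ρ j k) := by
  have h : ∀ a b : Fin N, trace (ρ * Matrix.single a b 1) = ρ b a := by
    intro a b
    simp [Matrix.trace_mul_single]
  refine ⟨?_, ?_⟩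
  · simp only [Proj, Sgen, mul_add, mul_sub, Matrix.mul_smul, Matrix.trace_add,
      Matrix.trace_sub, Matrix.trace_smul, h, smul_eq_mul]
    linear_combination (-(ρ k j - ρ j k) / 2) * Complex.I_mul_I
  · exact (hρ.isHermitian.apply k j).symm
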